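/- arXiv:1806.03598 — 5 statements merged into one kernel-verified Lean document; each statement's English description precedes it below -/
import Mathlib

section
/- Λ = (W_j, Λ_j, v_j) is a g-fusion frame for H if and only if the operator S_Λ : H → H, S_Λ f = Σ_{j∈J} v_j² π_{W_j} Λ_j* Λ_j π_{W_j} f, is well-defined, bounded and surjective. -/
noncomputable section

open ContinuousLinearMap Submodule Set

variable {H : Type*} [NormedAddCommGroup H] [InnerProductSpace ℂ H] [CompleteSpace H]

/-- The orthogonal projection onto a (complete, i.e. closed) subspace `K` of `H`,
viewed as a continuous endomorphism of `H`. -/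
def gfP (K : Submodule ℂ H) [CompleteSpace K] : H →L[ℂ] H :=
  K.subtypeL.comp (orthogonalProjection K)

section GFrame

variable {ι : Type*} {G : ι → Type*} [∀ j, NormedAddCommGroup (G j)]
  [∀ j, InnerProductSpace ℂ (G j)] [∀ j, CompleteSpace (G j)] {T : ∀ j, H →L[ℂ] G j}

theorem norm_sum_adjoint_apply_sq_le {B : ℝ}
    (hB : ∀ (F : Finset ι) (f : H), ∑ j ∈ F, ‖T j f‖ ^ 2 ≤ B * ‖f‖ ^ 2)
    (F : Finset ι) (f : H) :
    ‖∑ j ∈ F, adjoint (T j) (T j f)‖ ^ 2 ≤ B * ∑ j ∈ F, ‖T j f‖ ^ 2 := by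
  set x := ∑ j ∈ F, adjoint (T j) (T j f) with hx
  have h1 : ‖x‖ ^ 2 ≤ ∑ j ∈ F, ‖T j f‖ * ‖T j x‖ := by
    calc ‖x‖ ^ 2 = RCLike.re (inner ℂ x x) := (inner_self_eq_norm_sq (𝕜 := ℂ) x).symm
      _ = ∑ j ∈ F, RCLike.re (inner ℂ (T j f) (T j x)) := by
        conv_lhs => enter [2, 2]; rw [hx]
        simp only [sum_inner, map_sum, adjoint_inner_left]
      _ ≤ ∑ j ∈ F, ‖T j f‖ * ‖T j x‖ := Finset.sum_le_sum fun j _ => re_inner_le_norm _ _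
  have h2 : (‖x‖ ^ 2) ^ 2 ≤ (∑ j ∈ F, ‖T j f‖ ^ 2) * (B * ‖x‖ ^ 2) :=
    calc (‖x‖ ^ 2) ^ 2 ≤ (∑ j ∈ F, ‖T j f‖ * ‖T j x‖) ^ 2 := by gcongr
      _ ≤ (∑ j ∈ F, ‖T j f‖ ^ 2) * ∑ j ∈ F, ‖T j x‖ ^ 2 := Finset.sum_mul_sq_le_sq_mul_sq _ _ _
      _ ≤ _ := by gcongr; exact hB F x
  rcases eq_or_ne x 0 with h0 | h0
  · rw [h0, norm_zero, zero_pow two_ne_zero]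
    rcases eq_or_ne f 0 with hf | hf
    · simp [hf]
    · have hf' : 0 < ‖f‖ ^ 2 := by positivity
      have hB0 : 0 ≤ B := by
        have := hB ∅ f
        simp only [Finset.sum_empty] at this
        exact nonneg_of_mul_nonneg_left this hf'
      positivity
  · have : 0 < ‖x‖ ^ 2 := by positivity
    nlinarith

theorem summable_adjoint_apply {B : ℝ}
    (hB : ∀ (F : Finset ι) (f : H), ∑ j ∈ F, ‖T j f‖ ^ 2 ≤ B * ‖f‖ ^ 2) (f : H) :
    Summable fun j => adjoint (T j) (T j f) := by
  have hs : Summable fun j => ‖T j f‖ ^ 2 :=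
    summable_of_sum_le (fun j => by positivity) fun F => hB F f
  rw [summable_iff_vanishing_norm] at hs ⊢
  intro ε hε
  obtain ⟨s, hs⟩ := hs (ε ^ 2 / (|B| + 1)) (by positivity)
  refine ⟨s, fun t ht => ?_⟩
  have h1 := hs t ht
  rw [Real.norm_of_nonneg (by positivity), lt_div_iff₀ (by positivity)] at h1
  have h2 := norm_sum_adjoint_apply_sq_le hB t f
  have h3 : 0 ≤ ∑ j ∈ t, ‖T j f‖ ^ 2 := by positivity
  refine lt_of_pow_lt_pow_left₀ 2 hε.le ?_
  nlinarith [le_abs_self B]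

theorem hasSum_norm_sq_of_hasSum_adjoint_apply {f y : H}
    (h : HasSum (fun j => adjoint (T j) (T j f)) y) :
    HasSum (fun j => ‖T j f‖ ^ 2) (RCLike.re (inner ℂ y f)) := by
  have h1 := (h.mapL (innerSL ℂ f)).mapL (RCLike.reCLM (K := ℂ))
  simpa [adjoint_inner_right, ← inner_self_eq_norm_sq (𝕜 := ℂ), inner_re_symm (𝕜 := ℂ) y f]
    using h1

theorem norm_sq_le_of_hasSum_adjoint_apply {B : ℝ}
    (hB : ∀ (F : Finset ι) (f : H), ∑ j ∈ F, ‖T j f‖ ^ 2 ≤ B * ‖f‖ ^ 2) {f y : H}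
    (h : HasSum (fun j => adjoint (T j) (T j f)) y) :
    ‖y‖ ^ 2 ≤ B * RCLike.re (inner ℂ y f) :=
  le_of_tendsto_of_tendsto' (h.norm.pow 2)
    ((hasSum_norm_sq_of_hasSum_adjoint_apply h).mul_left B |>.congr fun F => by
      rw [Finset.mul_sum])
    fun F => norm_sum_adjoint_apply_sq_le hB F f

theorem inner_eq_of_hasSum_adjoint_apply {S : H → H}
    (h : ∀ f, HasSum (fun j => adjoint (T j) (T j f)) (S f)) (f g : H) :
    inner ℂ (S f) g = inner ℂ f (S g) := by
  have h1 := (h f).mapL (innerSL ℂ g)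
  have h2 := (h g).mapL (innerSL ℂ f)
  simp only [innerSL_apply_apply, adjoint_inner_right] at h1 h2
  have h3 := h1.star
  simp only [RCLike.star_def, inner_conj_symm] at h3
  exact h3.unique h2

theorem exists_surjective_of_frame_bounds {A B : ℝ} (hA : 0 < A)
    (h : ∀ f : H, Summable (fun j => ‖T j f‖ ^ 2) ∧ A * ‖f‖ ^ 2 ≤ ∑' j, ‖T j f‖ ^ 2 ∧
      ∑' j, ‖T j f‖ ^ 2 ≤ B * ‖f‖ ^ 2) :
    ∃ S : H →L[ℂ] H, (∀ f, HasSum (fun j => adjoint (T j) (T j f)) (S f)) ∧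
      Function.Surjective S := by
  have hB (F : Finset ι) (f : H) : ∑ j ∈ F, ‖T j f‖ ^ 2 ≤ B * ‖f‖ ^ 2 :=
    ((h f).1.sum_le_tsum F fun j _ => by positivity).trans (h f).2.2
  have hS (f : H) := (summable_adjoint_apply hB f).hasSum
  let S₀ : H →ₗ[ℂ] H :=
    { toFun := fun f => ∑' j, adjoint (T j) (T j f)
      map_add' := fun f g => (hS (f + g)).unique (by simpa using (hS f).add (hS g))
      map_smul' := fun c f => (hS (c • f)).unique (by simpa using (hS f).const_smul c) }
  have hbound (f : H) : ‖S₀ f‖ ≤ |B| * ‖f‖ := by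
    have h1 : ‖S₀ f‖ ^ 2 ≤ B * RCLike.re (inner ℂ (S₀ f) f) :=
      norm_sq_le_of_hasSum_adjoint_apply hB (hS f)
    have h2 : RCLike.re (inner ℂ (S₀ f) f) ≤ B * ‖f‖ ^ 2 :=
      (hasSum_norm_sq_of_hasSum_adjoint_apply (hS f)).tsum_eq ▸ (h f).2.2
    have h3 : 0 ≤ RCLike.re (inner ℂ (S₀ f) f) :=
      (hasSum_norm_sq_of_hasSum_adjoint_apply (hS f)).nonneg fun j => by positivity
    refine (pow_le_pow_iff_left₀ (norm_nonneg _) (by positivity) two_ne_zero).mp ?_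
    calc ‖S₀ f‖ ^ 2 ≤ |B| * (|B| * ‖f‖ ^ 2) := by
          refine h1.trans ?_
          gcongr
          · exact le_abs_self B
          · exact h2.trans (by gcongr; exact le_abs_self B)
      _ = (|B| * ‖f‖) ^ 2 := by ring
  let S : H →L[ℂ] H := S₀.mkContinuous |B| hbound
  have hS' (f : H) : HasSum (fun j => adjoint (T j) (T j f)) (S f) := hS f
  have hlow (f : H) : A * ‖f‖ ^ 2 ≤ RCLike.re (inner ℂ (S f) f) :=
    (hasSum_norm_sq_of_hasSum_adjoint_apply (hS' f)).tsum_eq ▸ (h f).2.1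
  refine ⟨S, hS', ?_⟩
  have hanti : AntilipschitzWith (Real.toNNReal A⁻¹) S := by
    refine S.antilipschitz_of_bound fun f => ?_
    rw [Real.coe_toNNReal _ (by positivity), inv_mul_eq_div, le_div_iff₀ hA]
    have h1 := (hlow f).trans (re_inner_le_norm (𝕜 := ℂ) _ _)
    rcases eq_or_ne f 0 with hf | hf
    · simp [hf]
    · have : 0 < ‖f‖ := by positivity
      nlinarith
  have hclosed : IsClosed (S.range : Set H) := by
    exact hanti.isClosed_range S.uniformContinuous
  have : CompleteSpace S.range := hclosed.completeSpace_coe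
  refine LinearMap.range_eq_top.mp ((Submodule.orthogonal_eq_bot_iff).mp ?_)
  rw [eq_bot_iff]
  intro f hf
  have h0 : inner ℂ (S f) f = 0 := hf (S f) ⟨f, rfl⟩
  have h1 := hlow f
  rw [h0, map_zero] at h1
  have h2 : ‖f‖ ^ 2 ≤ 0 := nonpos_of_mul_nonpos_right h1 hA
  simpa using le_antisymm h2 (by positivity)

theorem exists_frame_bounds_of_surjective {S : H →L[ℂ] H}
    (h : ∀ f, HasSum (fun j => adjoint (T j) (T j f)) (S f)) (hS : Function.Surjective S) :
    ∃ A B : ℝ, 0 < A ∧ A ≤ B ∧ ∀ f : H, Summable (fun j => ‖T j f‖ ^ 2) ∧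
      A * ‖f‖ ^ 2 ≤ ∑' j, ‖T j f‖ ^ 2 ∧ ∑' j, ‖T j f‖ ^ 2 ≤ B * ‖f‖ ^ 2 := by
  have hsum (f : H) := hasSum_norm_sq_of_hasSum_adjoint_apply (h f)
  set B := ‖S‖ + 1 with hBdef
  have hB0 : 0 < B := by positivity
  have hup (f : H) : RCLike.re (inner ℂ (S f) f) ≤ B * ‖f‖ ^ 2 :=
    calc RCLike.re (inner ℂ (S f) f) ≤ ‖S f‖ * ‖f‖ := re_inner_le_norm _ _
      _ ≤ (‖S‖ * ‖f‖) * ‖f‖ := by gcongr; exact S.le_opNorm f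
      _ ≤ B * ‖f‖ ^ 2 := by nlinarith [sq_nonneg ‖f‖]
  have hB (F : Finset ι) (f : H) : ∑ j ∈ F, ‖T j f‖ ^ 2 ≤ B * ‖f‖ ^ 2 :=
    (sum_le_hasSum F (fun j _ => by positivity) (hsum f)).trans (hup f)
  obtain ⟨C, hC, hpre⟩ := S.exists_preimage_norm_le hS
  have hinv (f : H) : ‖f‖ ≤ C * ‖S f‖ := by
    obtain ⟨x, hx, hxn⟩ := hpre f
    have h1 : ‖f‖ ^ 2 ≤ ‖x‖ * ‖S f‖ := by
      rw [← inner_self_eq_norm_sq (𝕜 := ℂ)]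
      nth_rw 1 [← hx]
      rw [inner_eq_of_hasSum_adjoint_apply h]
      exact re_inner_le_norm _ _
    rcases eq_or_ne f 0 with hf | hf
    · simp [hf]
    · have : 0 < ‖f‖ := by positivity
      have h2 : ‖x‖ * ‖S f‖ ≤ C * ‖f‖ * ‖S f‖ := by gcongr
      nlinarith
  refine ⟨min (C ^ 2 * B)⁻¹ B, B, by positivity, min_le_right _ _, fun f =>
    ⟨(hsum f).summable, ?_, (hsum f).tsum_eq ▸ hup f⟩⟩
  rw [(hsum f).tsum_eq]
  calc min (C ^ 2 * B)⁻¹ B * ‖f‖ ^ 2 ≤ (C ^ 2 * B)⁻¹ * ‖f‖ ^ 2 := by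
        gcongr; exact min_le_left _ _
    _ ≤ RCLike.re (inner ℂ (S f) f) := by
      rw [inv_mul_eq_div, div_le_iff₀ (by positivity)]
      calc ‖f‖ ^ 2 ≤ (C * ‖S f‖) ^ 2 := by gcongr; exact hinv f
        _ = C ^ 2 * ‖S f‖ ^ 2 := by ring
        _ ≤ C ^ 2 * (B * RCLike.re (inner ℂ (S f) f)) := by
          gcongr; exact norm_sq_le_of_hasSum_adjoint_apply hB (h f)
        _ = _ := by ring

end GFrame

theorem adjoint_gfP (K : Submodule ℂ H) [CompleteSpace K] : adjoint (gfP K) = gfP K :=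
  (isSelfAdjoint_starProjection K).adjoint_eq

/-- `(W j, Λ j, v j)` is a g-fusion frame for `H` iff the operator
`S : H → H`, `S f = ∑ j, v j ^ 2 • π_{W j} (Λ j)* (Λ j (π_{W j} f))`, is a well-defined,
bounded and surjective operator. -/
theorem stmt7 {ι : Type*} [Countable ι] {G : ι → Type*}
    [∀ j, NormedAddCommGroup (G j)] [∀ j, InnerProductSpace ℂ (G j)] [∀ j, CompleteSpace (G j)]
    (W : ι → Submodule ℂ H) [∀ j, CompleteSpace (W j)]
    (Λ : ∀ j, H →L[ℂ] G j) (v : ι → ℝ) (hv : ∀ j, 0 < v j) :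
    (∃ A B : ℝ, 0 < A ∧ A ≤ B ∧ ∀ f : H,
        Summable (fun j => (v j) ^ 2 * ‖Λ j (gfP (W j) f)‖ ^ 2) ∧
        A * ‖f‖ ^ 2 ≤ ∑' j, (v j) ^ 2 * ‖Λ j (gfP (W j) f)‖ ^ 2 ∧
        ∑' j, (v j) ^ 2 * ‖Λ j (gfP (W j) f)‖ ^ 2 ≤ B * ‖f‖ ^ 2) ↔
    (∃ S : H →L[ℂ] H,
      (∀ f : H,
        HasSum (fun j =>
          (v j) ^ 2 • gfP (W j) (ContinuousLinearMap.adjoint (Λ j) (Λ j (gfP (W j) f)))) (S f)) ∧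
      Function.Surjective S) := by
  let T : ∀ j, H →L[ℂ] G j := fun j => (v j : ℂ) • (Λ j).comp (gfP (W j))
  have hnorm (j : ι) (f : H) : (v j) ^ 2 * ‖Λ j (gfP (W j) f)‖ ^ 2 = ‖T j f‖ ^ 2 := by
    simp [T, norm_smul, mul_pow]
  have hadj (j : ι) (f : H) :
      (v j) ^ 2 • gfP (W j) (ContinuousLinearMap.adjoint (Λ j) (Λ j (gfP (W j) f))) =
        adjoint (T j) (T j f) := by
    simp only [T, map_smulₛₗ, adjoint_comp, adjoint_gfP, FunLike.coe_smul, coe_comp, Pi.smul_apply,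
      Function.comp_apply, Complex.conj_ofReal, smul_smul, RingHom.id_apply]
    rw [← Complex.coe_smul]
    push_cast
    rw [sq]
  simp only [hnorm, hadj]
  constructor
  · rintro ⟨A, B, hA, -, h⟩
    exact exists_surjective_of_frame_bounds hA h
  · rintro ⟨S, h, hS⟩
    exact exists_frame_bounds_of_surjective h hS
end
end

section
/- Let Λ = (W_j, Λ_j, v_j) and Θ = (W_j, Θ_j, v_j) be g-fusion Bessel sequences for H with bounds B₁ and B₂ respectively, with synthesis operators T_Λ and T_Θ. If T_Θ T_Λ* = I_H, then Λ is a g-fusion frame for H with lower bound B₂^{-1} and Θ is a g-fusion frame for H with lower bound B₁^{-1}. -/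
noncomputable section

open ContinuousLinearMap Submodule Set

variable {H : Type*} [NormedAddCommGroup H] [InnerProductSpace ℂ H] [CompleteSpace H]

theorem inner_gfP_left_eq_right {E : Type*} [NormedAddCommGroup E] [InnerProductSpace ℂ E]
    (K : Submodule ℂ E) [CompleteSpace K] (x y : E) :
    inner ℂ (gfP K x) y = inner ℂ x (gfP K y) :=
  Submodule.inner_starProjection_left_eq_right K x y

section Synthesis

variable {ι : Type*} {G : ι → Type*} [∀ j, NormedAddCommGroup (G j)]
  [∀ j, InnerProductSpace ℂ (G j)] [∀ j, CompleteSpace (G j)]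
  {W : ι → Submodule ℂ H} [∀ j, CompleteSpace (W j)] {Λ : ∀ j, H →L[ℂ] G j} {v : ι → ℝ}
  {T : lp G 2 →L[ℂ] H}

/-- The adjoint of the synthesis operator is the analysis operator. -/
theorem adjoint_synthesis_apply
    (hT : ∀ f : lp G 2, HasSum (fun j => v j • gfP (W j) (adjoint (Λ j) (f j))) (T f))
    (f : H) (j : ι) : (adjoint T f) j = v j • Λ j (gfP (W j) f) := by
  classical
  refine ext_inner_left ℂ fun e => ?_
  have hsingle : T (lp.single 2 j e) = v j • gfP (W j) (adjoint (Λ j) e) := by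
    refine (hT _).unique ?_
    convert hasSum_single j fun i hi => ?_ using 1
    · rw [lp.single_apply_self]
    · rw [lp.single_apply_ne 2 j e hi, map_zero, map_zero, smul_zero]
  rw [← lp.inner_single_left, adjoint_inner_right, hsingle, inner_smul_left_eq_smul,
    inner_gfP_left_eq_right, adjoint_inner_left, inner_smul_right_eq_smul]

theorem norm_sq_adjoint_synthesis
    (hT : ∀ f : lp G 2, HasSum (fun j => v j • gfP (W j) (adjoint (Λ j) (f j))) (T f))
    (f : H) : ‖adjoint T f‖ ^ 2 = ∑' j, v j ^ 2 * ‖Λ j (gfP (W j) f)‖ ^ 2 := by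
  have hnorm := lp.norm_rpow_eq_tsum (p := 2) (by norm_num) (adjoint T f)
  simpa [adjoint_synthesis_apply hT, norm_smul, mul_pow] using hnorm

end Synthesis

/-- If `S ∘ T* = I` and `‖S* f‖² ≤ B ‖f‖²`, then `B⁻¹` is a lower bound for `T*`. -/
theorem inv_mul_norm_sq_le_of_leftInverse {E : Type*} [NormedAddCommGroup E]
    [InnerProductSpace ℂ E] [CompleteSpace E] {S T : E →L[ℂ] H} {B : ℝ}
    (hB : ∀ f, ‖adjoint S f‖ ^ 2 ≤ B * ‖f‖ ^ 2) (h : ∀ f, S (adjoint T f) = f) (f : H) :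
    B⁻¹ * ‖f‖ ^ 2 ≤ ‖adjoint T f‖ ^ 2 := by
  obtain rfl | hf := eq_or_ne f 0
  · simp
  have hpos : 0 < ‖f‖ ^ 2 := by positivity
  have hcs : ‖f‖ ^ 2 ≤ ‖adjoint T f‖ * ‖adjoint S f‖ := by
    have := norm_inner_le_norm (𝕜 := ℂ) (adjoint T f) (adjoint S f)
    rw [adjoint_inner_right, h, inner_self_eq_norm_sq_to_K] at this
    simpa using this
  have hsq : ‖f‖ ^ 2 * ‖f‖ ^ 2 ≤ ‖adjoint T f‖ ^ 2 * B * ‖f‖ ^ 2 := by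
    calc ‖f‖ ^ 2 * ‖f‖ ^ 2 ≤ (‖adjoint T f‖ * ‖adjoint S f‖) * (‖adjoint T f‖ * ‖adjoint S f‖) :=
          mul_self_le_mul_self hpos.le hcs
      _ = ‖adjoint T f‖ ^ 2 * ‖adjoint S f‖ ^ 2 := by ring
      _ ≤ ‖adjoint T f‖ ^ 2 * (B * ‖f‖ ^ 2) := by gcongr; exact hB f
      _ = ‖adjoint T f‖ ^ 2 * B * ‖f‖ ^ 2 := by ring
  have hle : ‖f‖ ^ 2 ≤ ‖adjoint T f‖ ^ 2 * B := le_of_mul_le_mul_right hsq hpos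
  have hBpos : 0 < B := pos_of_mul_pos_right (hpos.trans_le hle) (sq_nonneg _)
  rwa [inv_mul_le_iff₀ hBpos, mul_comm B]

/-- If `(W j, Λ j, v j)` and `(W j, Θ j, v j)` are g-fusion Bessel sequences
with bounds `B₁`, `B₂` and synthesis operators `TΛ`, `TΘ`, and `TΘ ∘ TΛ* = I`, then both are
g-fusion frames: `Λ` with lower bound `B₂⁻¹` and `Θ` with lower bound `B₁⁻¹`. -/
theorem stmt8 {ι : Type*} [Countable ι] {G : ι → Type*}
    [∀ j, NormedAddCommGroup (G j)] [∀ j, InnerProductSpace ℂ (G j)] [∀ j, CompleteSpace (G j)]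
    (W : ι → Submodule ℂ H) [∀ j, CompleteSpace (W j)]
    (Λ Θ : ∀ j, H →L[ℂ] G j) (v : ι → ℝ) (hv : ∀ j, 0 < v j) (B₁ B₂ : ℝ)
    (hΛ : ∀ f : H, Summable (fun j => (v j) ^ 2 * ‖Λ j (gfP (W j) f)‖ ^ 2) ∧
      ∑' j, (v j) ^ 2 * ‖Λ j (gfP (W j) f)‖ ^ 2 ≤ B₁ * ‖f‖ ^ 2)
    (hΘ : ∀ f : H, Summable (fun j => (v j) ^ 2 * ‖Θ j (gfP (W j) f)‖ ^ 2) ∧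
      ∑' j, (v j) ^ 2 * ‖Θ j (gfP (W j) f)‖ ^ 2 ≤ B₂ * ‖f‖ ^ 2)
    (TΛ TΘ : lp G 2 →L[ℂ] H)
    (hTΛ : ∀ f : lp G 2,
      HasSum (fun j => v j • gfP (W j) (ContinuousLinearMap.adjoint (Λ j) (f j))) (TΛ f))
    (hTΘ : ∀ f : lp G 2,
      HasSum (fun j => v j • gfP (W j) (ContinuousLinearMap.adjoint (Θ j) (f j))) (TΘ f))
    (h : ∀ f : H, TΘ (ContinuousLinearMap.adjoint TΛ f) = f) :
    (∀ f : H, B₂⁻¹ * ‖f‖ ^ 2 ≤ ∑' j, (v j) ^ 2 * ‖Λ j (gfP (W j) f)‖ ^ 2) ∧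
    (∀ f : H, B₁⁻¹ * ‖f‖ ^ 2 ≤ ∑' j, (v j) ^ 2 * ‖Θ j (gfP (W j) f)‖ ^ 2) := by
  have hdual : ∀ f : H, TΛ (adjoint TΘ f) = f := fun f => by
    refine ext_inner_left ℂ fun g => ?_
    rw [← adjoint_inner_left, adjoint_inner_right, h]
  simp only [← norm_sq_adjoint_synthesis hTΛ, ← norm_sq_adjoint_synthesis hTΘ] at hΛ hΘ ⊢
  exact ⟨inv_mul_norm_sq_le_of_leftInverse (fun f => (hΘ f).2) h,
    inv_mul_norm_sq_le_of_leftInverse (fun f => (hΛ f).2) hdual⟩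
end
end

section
/- If Λ = (W_j, Λ_j, v_j) is a g-fusion frame for H with bounds A, B and frame operator S_Λ, then the canonical dual triple (S_Λ^{-1} W_j, Λ_j π_{W_j} S_Λ^{-1}, v_j) is a g-fusion frame for H, with lower bound B^{-1} and upper bound B‖S_Λ^{-1}‖². -/
noncomputable section

open ContinuousLinearMap Submodule Set

variable {H : Type*} [NormedAddCommGroup H] [InnerProductSpace ℂ H] [CompleteSpace H]

/-- The orthogonal projection onto the topological closure of a subspace `K` of `H`
(for a subspace which is already closed, e.g. the image of a closed subspace under a
topological isomorphism, this is the projection onto `K` itself). -/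
def gfPc (K : Submodule ℂ H) : H →L[ℂ] H :=
  haveI : CompleteSpace K.topologicalClosure :=
    K.isClosed_topologicalClosure.completeSpace_coe
  (K.topologicalClosure).subtypeL.comp (orthogonalProjection K.topologicalClosure)

omit [CompleteSpace H] in
theorem gfP_eq_starProjection (K : Submodule ℂ H) [CompleteSpace K] :
    gfP K = K.starProjection := rfl

omit [CompleteSpace H] in
theorem inner_gfP_left (K : Submodule ℂ H) [CompleteSpace K] (x y : H) :
    inner ℂ (gfP K x) y = inner ℂ x (gfP K y) := by
  rw [gfP_eq_starProjection]
  exact K.inner_starProjection_left_eq_right x y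

/-- If `u` is a symmetric bounded operator, then `π_V u π_{uV} = π_V u`. -/
theorem gfP_comp_gfPc_map (K : Submodule ℂ H) [CompleteSpace K] (u : H →L[ℂ] H)
    (hu : ∀ x y, inner ℂ (u x) y = inner ℂ x (u y)) (f : H) :
    gfP K (u (gfPc (K.map (u : H →ₗ[ℂ] H)) f)) = gfP K (u f) := by
  have : CompleteSpace (K.map (u : H →ₗ[ℂ] H)).topologicalClosure :=
    (K.map (u : H →ₗ[ℂ] H)).isClosed_topologicalClosure.completeSpace_coe
  have hc : gfPc (K.map (u : H →ₗ[ℂ] H)) = gfP (K.map (u : H →ₗ[ℂ] H)).topologicalClosure := rfl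
  refine ext_inner_right ℂ fun y => ?_
  have hmem : u (gfP K y) ∈ (K.map (u : H →ₗ[ℂ] H)).topologicalClosure :=
    Submodule.le_topologicalClosure _
      (Submodule.mem_map_of_mem (f := (u : H →ₗ[ℂ] H)) (K.starProjection_apply_mem y))
  rw [inner_gfP_left, inner_gfP_left, hu, hu, hc, inner_gfP_left]
  congr 1
  exact Submodule.starProjection_eq_self_iff.mpr hmem

omit [CompleteSpace H] in
/-- A symmetric operator `S` with `0 ≤ ⟪S x, x⟫ ≤ B ‖x‖²` satisfies `‖S x‖² ≤ B ⟪S x, x⟫`. -/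
theorem inv_mul_norm_sq_le_re_inner (S : H →L[ℂ] H)
    (hS : ∀ x y, inner ℂ (S x) y = inner ℂ x (S y)) {B : ℝ} (hB : 0 < B)
    (hpos : ∀ x, 0 ≤ (inner ℂ (S x) x).re) (hle : ∀ x, (inner ℂ (S x) x).re ≤ B * ‖x‖ ^ 2)
    (g : H) : B⁻¹ * ‖S g‖ ^ 2 ≤ (inner ℂ (S g) g).re := by
  have h := hpos (g - ((B⁻¹ : ℝ) : ℂ) • S g)
  have hself : (inner ℂ (S g) (S g)).re = ‖S g‖ ^ 2 := inner_self_eq_norm_sq (𝕜 := ℂ) (S g)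
  have hexp : (inner ℂ (S (g - ((B⁻¹ : ℝ) : ℂ) • S g)) (g - ((B⁻¹ : ℝ) : ℂ) • S g)).re =
      (inner ℂ (S g) g).re - 2 * (B⁻¹ * ‖S g‖ ^ 2)
        + B⁻¹ * (B⁻¹ * (inner ℂ (S (S g)) (S g)).re) := by
    rw [map_sub, map_smul, inner_sub_left, inner_sub_right, inner_sub_right, inner_smul_left,
      inner_smul_left, inner_smul_right, inner_smul_right, hS (S g) g, Complex.conj_ofReal]
    simp only [Complex.sub_re, Complex.re_ofReal_mul, hself]
    ring
  have hb : B⁻¹ * (B⁻¹ * (inner ℂ (S (S g)) (S g)).re) ≤ B⁻¹ * ‖S g‖ ^ 2 := by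
    refine mul_le_mul_of_nonneg_left ?_ (inv_nonneg.mpr hB.le)
    rw [inv_mul_le_iff₀ hB]
    exact hle (S g)
  linarith

/-- The sesquilinear form of a frame operator as a sum over the frame. -/
theorem hasSum_inner_frameOperator {ι : Type*} {G : ι → Type*}
    [∀ j, NormedAddCommGroup (G j)] [∀ j, InnerProductSpace ℂ (G j)] [∀ j, CompleteSpace (G j)]
    (W : ι → Submodule ℂ H) [∀ j, CompleteSpace (W j)]
    (Λ : ∀ j, H →L[ℂ] G j) (v : ι → ℝ) {f y : H}
    (hS : HasSum (fun j =>
      (v j) ^ 2 • gfP (W j) (ContinuousLinearMap.adjoint (Λ j) (Λ j (gfP (W j) f)))) y) (g : H) :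
    HasSum (fun j => (((v j) ^ 2 : ℝ) : ℂ) *
      inner ℂ (Λ j (gfP (W j) g)) (Λ j (gfP (W j) f))) (inner ℂ g y) := by
  have hterm : (fun j => (((v j) ^ 2 : ℝ) : ℂ) *
      inner ℂ (Λ j (gfP (W j) g)) (Λ j (gfP (W j) f))) = fun j => innerSL ℂ g
        ((v j) ^ 2 • gfP (W j) (ContinuousLinearMap.adjoint (Λ j) (Λ j (gfP (W j) f)))) := by
    funext j
    rw [innerSL_apply_apply, ← Complex.coe_smul, inner_smul_right, ← inner_gfP_left,
      ContinuousLinearMap.adjoint_inner_right]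
  rw [hterm]
  exact hS.mapL (innerSL ℂ g)

/-- If `(W j, Λ j, v j)` is a g-fusion frame for `H` with bounds `A, B` and
frame operator `S` (with inverse `Sinv`), then the canonical dual
`(S⁻¹ W j, Λ j ∘ π_{W j} ∘ S⁻¹, v j)` is a g-fusion frame for `H` with lower bound `B⁻¹`
and upper bound `B‖S⁻¹‖²`. -/
theorem stmt9 {ι : Type*} [Countable ι] {G : ι → Type*}
    [∀ j, NormedAddCommGroup (G j)] [∀ j, InnerProductSpace ℂ (G j)] [∀ j, CompleteSpace (G j)]
    (W : ι → Submodule ℂ H) [∀ j, CompleteSpace (W j)]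
    (Λ : ∀ j, H →L[ℂ] G j) (v : ι → ℝ) (hv : ∀ j, 0 < v j)
    (A B : ℝ) (hA : 0 < A) (hAB : A ≤ B)
    (hframe : ∀ f : H, Summable (fun j => (v j) ^ 2 * ‖Λ j (gfP (W j) f)‖ ^ 2) ∧
      A * ‖f‖ ^ 2 ≤ ∑' j, (v j) ^ 2 * ‖Λ j (gfP (W j) f)‖ ^ 2 ∧
      ∑' j, (v j) ^ 2 * ‖Λ j (gfP (W j) f)‖ ^ 2 ≤ B * ‖f‖ ^ 2)
    (S Sinv : H →L[ℂ] H)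
    (hS : ∀ f : H,
      HasSum (fun j =>
        (v j) ^ 2 • gfP (W j) (ContinuousLinearMap.adjoint (Λ j) (Λ j (gfP (W j) f)))) (S f))
    (hS1 : ∀ f : H, S (Sinv f) = f) (hS2 : ∀ f : H, Sinv (S f) = f) :
    ∀ f : H,
      Summable (fun j =>
        (v j) ^ 2 * ‖Λ j (gfP (W j) (Sinv (gfPc ((W j).map (Sinv : H →ₗ[ℂ] H)) f)))‖ ^ 2) ∧
      B⁻¹ * ‖f‖ ^ 2 ≤
        ∑' j, (v j) ^ 2 * ‖Λ j (gfP (W j) (Sinv (gfPc ((W j).map (Sinv : H →ₗ[ℂ] H)) f)))‖ ^ 2 ∧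
      ∑' j, (v j) ^ 2 * ‖Λ j (gfP (W j) (Sinv (gfPc ((W j).map (Sinv : H →ₗ[ℂ] H)) f)))‖ ^ 2 ≤
        (B * ‖Sinv‖ ^ 2) * ‖f‖ ^ 2 := by
  have hB : 0 < B := hA.trans_le hAB
  have hSsym : ∀ x y, inner ℂ (S x) y = inner ℂ x (S y) := by
    intro x y
    have h₁ := (hasSum_inner_frameOperator W Λ v (hS x) y).star
    rw [← inner_conj_symm]
    refine h₁.unique ?_
    convert hasSum_inner_frameOperator W Λ v (hS y) x using 2 with j
    rw [star_mul', ← starRingEnd_apply, ← starRingEnd_apply, Complex.conj_ofReal, inner_conj_symm]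
  have hSinvsym : ∀ x y, inner ℂ (Sinv x) y = inner ℂ x (Sinv y) := by
    intro x y
    have h := hSsym (Sinv x) (Sinv y)
    rw [hS1, hS1] at h
    exact h.symm
  have hq : ∀ x, HasSum (fun j => (v j) ^ 2 * ‖Λ j (gfP (W j) x)‖ ^ 2) (inner ℂ (S x) x).re := by
    intro x
    rw [hSsym]
    convert Complex.hasSum_re (hasSum_inner_frameOperator W Λ v (hS x) x) using 2 with j
    rw [Complex.re_ofReal_mul]
    congr 1
    exact (inner_self_eq_norm_sq (𝕜 := ℂ) _).symm
  intro f
  simp only [gfP_comp_gfPc_map _ Sinv hSinvsym]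
  refine ⟨(hframe (Sinv f)).1, ?_, (hframe (Sinv f)).2.2.trans ?_⟩
  · rw [(hq (Sinv f)).tsum_eq]
    have h := inv_mul_norm_sq_le_re_inner S hSsym hB
      (fun x => (hq x).nonneg fun j => by positivity)
      (fun x => (hq x).tsum_eq ▸ (hframe x).2.2) (Sinv f)
    rwa [hS1] at h ⊢
  · rw [mul_assoc, ← mul_pow]
    gcongr
    exact Sinv.le_opNorm f
end
end

section
/- Λ = (W_j, Λ_j, v_j) is a g-fusion frame for H with bounds A, B if and only if the following two conditions hold: (I) the pair (W_j, Λ_j) is gf-complete; and (II) the operator T_Λ : {f_j} ↦ Σ_{j∈J} v_j π_{W_j} Λ_j* f_j is well-defined from ℋ₂ into H and satisfies A Σ_{j∈J} ‖f_j‖² ≤ ‖T_Λ({f_j})‖² ≤ B Σ_{j∈J} ‖f_j‖² for every {f_j} in the orthogonal complement of the kernel of T_Λ. -/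
noncomputable section

open ContinuousLinearMap Submodule Set

variable {H : Type*} [NormedAddCommGroup H] [InnerProductSpace ℂ H] [CompleteSpace H]

section AdjointBounds

variable {E F : Type*} [NormedAddCommGroup E] [InnerProductSpace ℂ E] [CompleteSpace E]
  [NormedAddCommGroup F] [InnerProductSpace ℂ F] [CompleteSpace F]

/-- An upper bound for a bounded operator is also one for its adjoint. -/
theorem norm_sq_adjoint_le {S : E →L[ℂ] F} {B : ℝ} (hB : 0 ≤ B)
    (h : ∀ x, ‖S x‖ ^ 2 ≤ B * ‖x‖ ^ 2) (y : F) : ‖adjoint S y‖ ^ 2 ≤ B * ‖y‖ ^ 2 := by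
  have hS : ‖S‖ ≤ √B := S.opNorm_le_bound (Real.sqrt_nonneg B) fun x =>
    le_of_sq_le_sq (by rw [mul_pow, Real.sq_sqrt hB]; exact h x) (by positivity)
  have h1 : ‖adjoint S y‖ ≤ √B * ‖y‖ :=
    (le_opNorm _ y).trans (by rw [LinearIsometryEquiv.norm_map]; gcongr)
  calc ‖adjoint S y‖ ^ 2 ≤ (√B * ‖y‖) ^ 2 := by gcongr
    _ = B * ‖y‖ ^ 2 := by rw [mul_pow, Real.sq_sqrt hB]

/-- A lower bound for `S` at `x` yields the same lower bound for the adjoint at `S x`. -/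
theorem le_norm_sq_adjoint_apply {S : E →L[ℂ] F} {A : ℝ} {x : E}
    (h : A * ‖x‖ ^ 2 ≤ ‖S x‖ ^ 2) : A * ‖S x‖ ^ 2 ≤ ‖adjoint S (S x)‖ ^ 2 := by
  rcases lt_or_ge A 0 with hA | hA
  · exact (mul_nonpos_of_nonpos_of_nonneg hA.le (sq_nonneg _)).trans (sq_nonneg _)
  rcases eq_or_ne (S x) 0 with h0 | h0
  · simp [h0]
  have h1 : ‖S x‖ ^ 2 ≤ ‖x‖ * ‖adjoint S (S x)‖ := by
    rw [← inner_self_eq_norm_sq (𝕜 := ℂ), ← adjoint_inner_right]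
    exact re_inner_le_norm _ _
  have h2 : 0 < ‖S x‖ ^ 2 := by positivity
  refine le_of_mul_le_mul_right ?_ h2
  calc A * ‖S x‖ ^ 2 * ‖S x‖ ^ 2 = A * (‖S x‖ ^ 2) ^ 2 := by ring
    _ ≤ A * (‖x‖ * ‖adjoint S (S x)‖) ^ 2 := by gcongr
    _ = ‖adjoint S (S x)‖ ^ 2 * (A * ‖x‖ ^ 2) := by ring
    _ ≤ ‖adjoint S (S x)‖ ^ 2 * ‖S x‖ ^ 2 := by gcongr

/-- A lower bound for an operator on a set extends to the closure of the set. -/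
theorem le_norm_sq_of_mem_closure {S : E →L[ℂ] F} {A : ℝ} {s : Set E}
    (h : ∀ x ∈ s, A * ‖x‖ ^ 2 ≤ ‖S x‖ ^ 2) {x : E} (hx : x ∈ closure s) :
    A * ‖x‖ ^ 2 ≤ ‖S x‖ ^ 2 :=
  closure_minimal (s := s) (t := {x | A * ‖x‖ ^ 2 ≤ ‖S x‖ ^ 2}) (fun y hy => Set.mem_setOf.2 (h y hy))
    (isClosed_le (by fun_prop) (by fun_prop)) hx

/-- Every value of `S` is attained on the orthogonal complement of the kernel, at a point of
no larger norm. -/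
theorem exists_mem_orthogonal_ker (S : E →L[ℂ] F) (x : E) :
    ∃ y ∈ (LinearMap.ker (S : E →ₗ[ℂ] F))ᗮ, S y = S x ∧ ‖y‖ ≤ ‖x‖ := by
  set K := LinearMap.ker (S : E →ₗ[ℂ] F) with hK
  have : CompleteSpace K := S.isClosed_ker.completeSpace_coe
  refine ⟨Kᗮ.starProjection x, Kᗮ.starProjection_apply_mem x, ?_, Kᗮ.norm_starProjection_apply_le x⟩
  have h1 : S (K.starProjection x) = 0 := K.starProjection_apply_mem x
  conv_rhs => rw [← K.starProjection_add_starProjection_orthogonal x, map_add, h1, zero_add]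

/-- An operator is bounded below and above by `A` and `B` iff its adjoint has dense range and has
the same bounds on the orthogonal complement of its kernel. -/
theorem adjoint_bounds_iff (S : E →L[ℂ] F) {A B : ℝ} (hA : 0 < A) (hB : 0 ≤ B) :
    (∀ y, A * ‖y‖ ^ 2 ≤ ‖adjoint S y‖ ^ 2 ∧ ‖adjoint S y‖ ^ 2 ≤ B * ‖y‖ ^ 2) ↔
      (LinearMap.range (S : E →ₗ[ℂ] F)).topologicalClosure = ⊤ ∧
        ∀ x ∈ (LinearMap.ker (S : E →ₗ[ℂ] F))ᗮ,
          A * ‖x‖ ^ 2 ≤ ‖S x‖ ^ 2 ∧ ‖S x‖ ^ 2 ≤ B * ‖x‖ ^ 2 := by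
  constructor
  · intro h
    refine ⟨?_, fun x hx => ⟨?_, ?_⟩⟩
    · rw [topologicalClosure_eq_top_iff, S.orthogonal_range, LinearMap.ker_eq_bot']
      intro y hy
      have h1 := (h y).1
      have h2 : adjoint S y = 0 := hy
      rw [h2, norm_zero] at h1
      have h3 : ‖y‖ ^ 2 ≤ 0 := by nlinarith
      simpa using le_antisymm h3 (sq_nonneg _)
    · rw [S.orthogonal_ker] at hx
      refine le_norm_sq_of_mem_closure ?_ (s := Set.range (adjoint S)) (by simpa using! hx)
      rintro _ ⟨y, rfl⟩
      simpa using le_norm_sq_adjoint_apply (h y).1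
    · simpa using norm_sq_adjoint_le hB (fun y => (h y).2) x
  · rintro ⟨hd, h⟩ y
    refine ⟨le_norm_sq_of_mem_closure (s := Set.range S) ?_ ?_, norm_sq_adjoint_le hB ?_ y⟩
    · rintro _ ⟨x, rfl⟩
      obtain ⟨z, hz, hzx, -⟩ := exists_mem_orthogonal_ker S x
      rw [← hzx]
      exact le_norm_sq_adjoint_apply (h z hz).1
    · have : y ∈ (LinearMap.range (S : E →ₗ[ℂ] F)).topologicalClosure := hd ▸ Submodule.mem_top
      simpa using! this
    · intro x
      obtain ⟨z, hz, hzx, hle⟩ := exists_mem_orthogonal_ker S x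
      rw [← hzx]
      exact (h z hz).2.trans (by gcongr)

end AdjointBounds

section Synthesis

variable {ι : Type*} {G : ι → Type*}
  [∀ j, NormedAddCommGroup (G j)] [∀ j, InnerProductSpace ℂ (G j)]

theorem lp_two_hasSum_norm_sq (f : lp G 2) : HasSum (fun j => ‖f j‖ ^ 2) (‖f‖ ^ 2) := by
  simpa using lp.hasSum_norm (p := 2) (by simp) f

/-- The analysis operator `f ↦ (a j f)` into `ℋ₂` of a family of operators `a j` satisfying a
Bessel inequality. -/
def analysisOp (a : ∀ j, H →L[ℂ] G j) {B : ℝ} (hB : 0 ≤ B)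
    (hs : ∀ f, Summable fun j => ‖a j f‖ ^ 2) (h : ∀ f, ∑' j, ‖a j f‖ ^ 2 ≤ B * ‖f‖ ^ 2) :
    H →L[ℂ] lp G 2 :=
  LinearMap.mkContinuous
    { toFun f := ⟨fun j => a j f, memℓp_gen (by simpa using hs f)⟩
      map_add' f g := by ext j; exact map_add (a j) f g
      map_smul' c f := by ext j; exact map_smul (a j) c f } √B fun f => by
    refine le_of_sq_le_sq ?_ (by positivity)
    rw [← (lp_two_hasSum_norm_sq _).tsum_eq, mul_pow, Real.sq_sqrt hB]
    exact h f

theorem analysisOp_apply (a : ∀ j, H →L[ℂ] G j) {B : ℝ} (hB : 0 ≤ B)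
    (hs : ∀ f, Summable fun j => ‖a j f‖ ^ 2) (h : ∀ f, ∑' j, ‖a j f‖ ^ 2 ≤ B * ‖f‖ ^ 2)
    (f : H) (j : ι) : analysisOp a hB hs h f j = a j f := rfl

variable [∀ j, CompleteSpace (G j)]

/-- The range of a synthesis operator and the span of the ranges of the operators `(a j)†` have
the same orthogonal complement. -/
theorem orthogonal_span_range_adjoint {a : ∀ j, H →L[ℂ] G j} {S : lp G 2 →L[ℂ] H}
    (hS : ∀ f j, adjoint S f j = a j f) :
    (span ℂ (⋃ j, Set.range (adjoint (a j))))ᗮ =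
      (LinearMap.range (S : lp G 2 →ₗ[ℂ] H))ᗮ := by
  rw [S.orthogonal_range]
  ext y
  rw [mem_orthogonal]
  have key : (∀ j, a j y = 0) ↔ y ∈ LinearMap.ker (adjoint S : H →ₗ[ℂ] lp G 2) := by
    rw [LinearMap.mem_ker]
    refine ⟨fun h => ?_, fun h j => ?_⟩
    · ext j
      simpa using! (hS y j).trans (h j)
    · rw [← hS y j]
      have h' : adjoint S y = 0 := h
      simp [h']
  rw [← key]
  constructor
  · intro h j
    rw [← inner_self_eq_zero (𝕜 := ℂ), ← adjoint_inner_left]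
    exact h _ (subset_span (Set.mem_iUnion.2 ⟨j, Set.mem_range_self _⟩))
  · intro h u hu
    induction hu using span_induction with
    | mem u hu =>
      obtain ⟨j, x, rfl⟩ := Set.mem_iUnion.1 hu
      rw [adjoint_inner_left, h j, inner_zero_right]
    | zero => simp
    | add u w _ _ hu hw => rw [inner_add_left, hu, hw, add_zero]
    | smul c u _ hu => rw [inner_smul_left, hu, mul_zero]

/-- A bounded operator is the synthesis operator of the family `a` iff its adjoint is the
analysis operator of `a`. -/
theorem hasSum_synthesis_iff {a : ∀ j, H →L[ℂ] G j} {S : lp G 2 →L[ℂ] H} :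
    (∀ f, HasSum (fun j => adjoint (a j) (f j)) (S f)) ↔ ∀ f j, adjoint S f j = a j f := by
  classical
  have single_iff : (∀ j x, S (lp.single 2 j x) = adjoint (a j) x) ↔
      ∀ f j, adjoint S f j = a j f := by
    constructor
    · intro h f j
      refine ext_inner_left ℂ fun x => ?_
      rw [← lp.inner_single_left, adjoint_inner_right, h, adjoint_inner_left]
    · intro h j x
      refine ext_inner_right ℂ fun f => ?_
      rw [← adjoint_inner_right, lp.inner_single_left, h, adjoint_inner_left]
  rw [← single_iff]
  constructor
  · intro h j x
    refine (h _).unique ?_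
    have := hasSum_single (f := fun i => adjoint (a i) (lp.single 2 j x i)) j fun i hi => by
      simp [hi]
    simpa only [lp.single_apply_self] using this
  · intro h f
    simpa [h] using (lp.hasSum_single (p := 2) (by simp) f).mapL S

/-- A linear map given by the pointwise sums of a synthesis series is continuous. -/
theorem continuous_of_hasSum_synthesis [Countable ι] {a : ∀ j, H →L[ℂ] G j} {T : lp G 2 →ₗ[ℂ] H}
    (hT : ∀ f, HasSum (fun j => adjoint (a j) (f j)) (T f)) : Continuous T :=
  (continuousLinearMapOfTendsto (l := Filter.atTop) (f := T)
    (fun s : Finset ι => ∑ j ∈ s, (adjoint (a j)).comp (lp.evalCLM ℂ G 2 j))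
    (tendsto_pi_nhds.2 fun f => by simpa [HasSum] using! hT f)).continuous

/-- The abstract form of the characterization of g-fusion frames, for a family of operators
`a j` which absorbs the weights and the projections. -/
theorem frame_iff_synthesis_bounds [Countable ι] (a : ∀ j, H →L[ℂ] G j) {A B : ℝ}
    (hA : 0 < A) (hB : 0 ≤ B) :
    (∀ f : H, Summable (fun j => ‖a j f‖ ^ 2) ∧
        A * ‖f‖ ^ 2 ≤ ∑' j, ‖a j f‖ ^ 2 ∧ ∑' j, ‖a j f‖ ^ 2 ≤ B * ‖f‖ ^ 2) ↔
      ((span ℂ (⋃ j, Set.range (adjoint (a j)))).topologicalClosure = ⊤ ∧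
        ∃ T : lp G 2 →ₗ[ℂ] H, (∀ f : lp G 2, HasSum (fun j => adjoint (a j) (f j)) (T f)) ∧
          ∀ f ∈ (LinearMap.ker T)ᗮ, A * ‖f‖ ^ 2 ≤ ‖T f‖ ^ 2 ∧ ‖T f‖ ^ 2 ≤ B * ‖f‖ ^ 2) := by
  have hsum (S : lp G 2 →L[ℂ] H) (hS : ∀ f j, adjoint S f j = a j f) (f : H) :
      HasSum (fun j => ‖a j f‖ ^ 2) (‖adjoint S f‖ ^ 2) := by
    simpa only [hS] using lp_two_hasSum_norm_sq (adjoint S f)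
  constructor
  · intro h
    obtain ⟨U, hU⟩ : ∃ U : H →L[ℂ] lp G 2, ∀ f j, U f j = a j f :=
      ⟨_, analysisOp_apply a hB (fun f => (h f).1) fun f => (h f).2.2⟩
    obtain ⟨S, rfl⟩ : ∃ S : lp G 2 →L[ℂ] H, adjoint S = U := ⟨adjoint U, adjoint_adjoint U⟩
    obtain ⟨hd, hb⟩ := (adjoint_bounds_iff S hA hB).1 fun f => by
      rw [← (hsum S hU f).tsum_eq]
      exact (h f).2
    refine ⟨?_, S, hasSum_synthesis_iff.2 hU, hb⟩
    rwa [topologicalClosure_eq_top_iff, orthogonal_span_range_adjoint hU,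
      ← topologicalClosure_eq_top_iff]
  · rintro ⟨hd, T, hT, hb⟩ f
    let S : lp G 2 →L[ℂ] H := ⟨T, continuous_of_hasSum_synthesis hT⟩
    have hS : ∀ f j, adjoint S f j = a j f := hasSum_synthesis_iff.1 hT
    rw [topologicalClosure_eq_top_iff, orthogonal_span_range_adjoint hS,
      ← topologicalClosure_eq_top_iff] at hd
    rw [(hsum S hS f).tsum_eq]
    exact ⟨(hsum S hS f).summable, (adjoint_bounds_iff S hA hB).2 ⟨hd, hb⟩ f⟩

end Synthesis

/-- Rescaling by nonzero scalars does not change the span of a union of ranges. -/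
theorem span_iUnion_range_smul {ι : Type*} {G : ι → Type*} [∀ j, AddCommGroup (G j)]
    [∀ j, Module ℂ (G j)] (b : ∀ j, G j →ₗ[ℂ] H) {c : ι → ℂ} (hc : ∀ j, c j ≠ 0) :
    span ℂ (⋃ j, Set.range fun x => c j • b j x) = span ℂ (⋃ j, Set.range (b j)) := by
  congr 1
  refine Set.iUnion_congr fun j => Set.Subset.antisymm ?_ ?_
  · rintro _ ⟨x, rfl⟩
    exact ⟨c j • x, map_smul _ _ _⟩
  · rintro _ ⟨x, rfl⟩
    exact ⟨(c j)⁻¹ • x, by simp [hc j]⟩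

/-- `(W j, Λ j, v j)` is a g-fusion frame for `H` with bounds `A, B` iff
(I) the pair `(W j, Λ j)` is gf-complete, and (II) the synthesis map
`T : {f j} ↦ ∑ j, v j • π_{W j} (Λ j)* (f j)` is well defined from `ℋ₂` to `H` (here: a
linear map representing the pointwise sums) and satisfies
`A ∑ j ‖f j‖² ≤ ‖T {f j}‖² ≤ B ∑ j ‖f j‖²` for every `{f j} ∈ (ker T)ᗮ`
(note `∑ j ‖f j‖² = ‖{f j}‖²` in `ℋ₂`). -/
theorem stmt17 {ι : Type*} [Countable ι] {G : ι → Type*}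
    [∀ j, NormedAddCommGroup (G j)] [∀ j, InnerProductSpace ℂ (G j)] [∀ j, CompleteSpace (G j)]
    (W : ι → Submodule ℂ H) [∀ j, CompleteSpace (W j)]
    (Λ : ∀ j, H →L[ℂ] G j) (v : ι → ℝ) (hv : ∀ j, 0 < v j)
    (A B : ℝ) (hA : 0 < A) (hAB : A ≤ B) :
    (∀ f : H, Summable (fun j => (v j) ^ 2 * ‖Λ j (gfP (W j) f)‖ ^ 2) ∧
        A * ‖f‖ ^ 2 ≤ ∑' j, (v j) ^ 2 * ‖Λ j (gfP (W j) f)‖ ^ 2 ∧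
        ∑' j, (v j) ^ 2 * ‖Λ j (gfP (W j) f)‖ ^ 2 ≤ B * ‖f‖ ^ 2) ↔
    ((Submodule.span ℂ
        (⋃ j, Set.range fun x : G j =>
          gfP (W j) (ContinuousLinearMap.adjoint (Λ j) x))).topologicalClosure = ⊤ ∧
      ∃ T : lp G 2 →ₗ[ℂ] H,
        (∀ f : lp G 2,
          HasSum (fun j => v j • gfP (W j) (ContinuousLinearMap.adjoint (Λ j) (f j))) (T f)) ∧
        ∀ f ∈ (LinearMap.ker T)ᗮ,
          A * ‖f‖ ^ 2 ≤ ‖T f‖ ^ 2 ∧ ‖T f‖ ^ 2 ≤ B * ‖f‖ ^ 2) := by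
  let a : ∀ j, H →L[ℂ] G j := fun j => (v j : ℂ) • (Λ j).comp (gfP (W j))
  have hnorm : ∀ j f, ‖a j f‖ ^ 2 = v j ^ 2 * ‖Λ j (gfP (W j) f)‖ ^ 2 := fun j f => by
    simp [a, norm_smul, mul_pow]
  have hadj : ∀ j x, adjoint (a j) x = (v j : ℂ) • gfP (W j) (adjoint (Λ j) x) := fun j x => by
    simp only [a, map_smulₛₗ, adjoint_comp, adjoint_gfP, Complex.conj_ofReal, smul_apply,
      comp_apply]
  have hspan : span ℂ (⋃ j, Set.range fun x => (v j : ℂ) • gfP (W j) (adjoint (Λ j) x)) =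
      span ℂ (⋃ j, Set.range fun x => gfP (W j) (adjoint (Λ j) x)) := span_iUnion_range_smul
    (fun j => ((gfP (W j)).comp (adjoint (Λ j)) : G j →ₗ[ℂ] H))
    (c := fun j => (v j : ℂ)) fun j => by exact_mod_cast (hv j).ne'
  have hrange : ∀ j, Set.range (adjoint (a j)) =
      Set.range fun x => (v j : ℂ) • gfP (W j) (adjoint (Λ j) x) := fun j =>
    congrArg Set.range (funext (hadj j))
  have key := frame_iff_synthesis_bounds a hA (hA.le.trans hAB)
  simp only [hnorm, hrange, hadj, hspan] at key
  simpa only [Complex.coe_smul] using key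
end
end

section
/- Λ = (W_j, Λ_j, v_j) is a g-fusion frame sequence (i.e. a g-fusion frame for the closed linear span of ∪_{j∈J} π_{W_j} Λ_j*(H_j)) if and only if the synthesis operator T_Λ : ℋ₂ → H, T_Λ({f_j}) = Σ_{j∈J} v_j π_{W_j} Λ_j* f_j, is well-defined and has closed range; moreover in that case the range of T_Λ equals the closed linear span of ∪_{j∈J} π_{W_j} Λ_j*(H_j). -/
noncomputable section

open ContinuousLinearMap Submodule Set

variable {H : Type*} [NormedAddCommGroup H] [InnerProductSpace ℂ H] [CompleteSpace H]

section Synthesis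

variable {ι : Type*} {G : ι → Type*}
  [∀ j, NormedAddCommGroup (G j)]

theorem hasSum_norm_sq (g : lp G 2) : HasSum (fun j => ‖g j‖ ^ 2) (‖g‖ ^ 2) := by
  simpa using lp.hasSum_norm (p := 2) (by norm_num) g

variable [∀ j, InnerProductSpace ℂ (G j)]

/-- `T` is the synthesis operator `f ↦ ∑ j, V j (f j)` of the family `V`. -/
def IsSynthesis (V : ∀ j, G j →L[ℂ] H) (T : lp G 2 →L[ℂ] H) : Prop :=
  ∀ f : lp G 2, HasSum (fun j => V j (f j)) (T f)

/-- The closed linear span of the ranges of the family `V`. -/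
def closedSpan (V : ∀ j, G j →L[ℂ] H) : Submodule ℂ H :=
  (span ℂ (⋃ j, range (V j))).topologicalClosure

theorem apply_mem_closedSpan (V : ∀ j, G j →L[ℂ] H) (j : ι) (x : G j) :
    V j x ∈ closedSpan V :=
  le_topologicalClosure _ (subset_span (mem_iUnion.2 ⟨j, x, rfl⟩))

theorem isClosed_closedSpan (V : ∀ j, G j →L[ℂ] H) : IsClosed (closedSpan V : Set H) :=
  isClosed_topologicalClosure _

namespace IsSynthesis

variable {V : ∀ j, G j →L[ℂ] H} {T : lp G 2 →L[ℂ] H}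

theorem apply_single [DecidableEq ι] (hT : IsSynthesis V T) (j : ι) (x : G j) :
    T (lp.single 2 j x) = V j x := by
  refine (hT _).unique ?_
  have h := hasSum_single (f := fun i => V i (lp.single 2 j x i)) j fun i hi => by
    simp only [lp.single_apply_ne 2 j x hi, map_zero]
  simpa only [lp.single_apply_self] using h

variable [∀ j, CompleteSpace (G j)]

theorem adjoint_apply (hT : IsSynthesis V T) (f : H) (j : ι) :
    adjoint T f j = adjoint (V j) f := by
  classical
  refine ext_inner_left ℂ fun x => ?_
  rw [← lp.inner_single_left, adjoint_inner_right, adjoint_inner_right, hT.apply_single]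

theorem hasSum_norm_adjoint (hT : IsSynthesis V T) (f : H) :
    HasSum (fun j => ‖adjoint (V j) f‖ ^ 2) (‖adjoint T f‖ ^ 2) := by
  simpa only [hT.adjoint_apply] using hasSum_norm_sq (adjoint T f)

theorem apply_mem (hT : IsSynthesis V T) (f : lp G 2) : T f ∈ closedSpan V :=
  (isClosed_closedSpan V).mem_of_tendsto (hT f)
    (Filter.Eventually.of_forall fun _ => sum_mem fun j _ => apply_mem_closedSpan V j (f j))

theorem range_eq (hT : IsSynthesis V T) (hc : IsClosed (range T)) :
    range T = closedSpan V := by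
  classical
  refine Subset.antisymm (range_subset_iff.2 hT.apply_mem) ?_
  have h : closedSpan V ≤ T.range := by
    refine topologicalClosure_minimal _ (span_le.2 (iUnion_subset fun j => ?_)) hc
    rintro _ ⟨x, rfl⟩
    exact ⟨lp.single 2 j x, hT.apply_single j x⟩
  exact h

/-- If the range of the synthesis operator is closed then its adjoint is bounded below on it. -/
theorem exists_lower_bound (hT : IsSynthesis V T) (hc : IsClosed (range T)) :
    ∃ C : ℝ, 0 < C ∧ ∀ f ∈ closedSpan V, ‖f‖ ≤ C * ‖adjoint T f‖ := by
  have : CompleteSpace (closedSpan V) := (isClosed_closedSpan V).completeSpace_coe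
  let S : lp G 2 →L[ℂ] closedSpan V := T.codRestrict _ hT.apply_mem
  have hS : Function.Surjective S := by
    rintro ⟨y, hy⟩
    obtain ⟨g, hg⟩ : y ∈ range T := hT.range_eq hc ▸ hy
    exact ⟨g, Subtype.ext hg⟩
  obtain ⟨C, hC, h⟩ := S.exists_preimage_norm_le hS
  refine ⟨C, hC, fun f hf => ?_⟩
  obtain ⟨g, hg, hgC⟩ := h ⟨f, hf⟩
  have hg : T g = f := congrArg Subtype.val hg
  have hgC : ‖g‖ ≤ C * ‖f‖ := hgC
  have key : ‖f‖ * ‖f‖ ≤ (C * ‖adjoint T f‖) * ‖f‖ := calc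
    ‖f‖ * ‖f‖ = ‖inner ℂ g (adjoint T f)‖ := by
      rw [adjoint_inner_right, hg, inner_self_eq_norm_sq_to_K]; simp [sq]
    _ ≤ ‖g‖ * ‖adjoint T f‖ := norm_inner_le_norm _ _
    _ ≤ (C * ‖f‖) * ‖adjoint T f‖ := by gcongr
    _ = _ := by ring
  rcases (norm_nonneg f).eq_or_lt with h0 | h0
  · rw [← h0]; positivity
  · exact le_of_mul_le_mul_right key h0

/-- If the adjoint of the synthesis operator is bounded below on the closed span then the
range of the synthesis operator is the closed span. -/
theorem range_eq_of_lower_bound (hT : IsSynthesis V T) {A : ℝ} (hA : 0 < A)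
    (h : ∀ f ∈ closedSpan V, A * ‖f‖ ^ 2 ≤ ‖adjoint T f‖ ^ 2) :
    range T = closedSpan V := by
  have : CompleteSpace (closedSpan V) := (isClosed_closedSpan V).completeSpace_coe
  refine Subset.antisymm (range_subset_iff.2 hT.apply_mem) fun y hy => ?_
  let S : lp G 2 →L[ℂ] closedSpan V := T.codRestrict _ hT.apply_mem
  let R : closedSpan V →L[ℂ] closedSpan V := S ∘L adjoint T ∘L (closedSpan V).subtypeL
  have hR : IsUnit R := by
    refine isUnit_of_forall_le_norm_inner_map R (c := ⟨A, hA.le⟩) hA fun x => ?_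
    have : inner ℂ (R x) x = inner ℂ (T (adjoint T (x : H))) (x : H) := rfl
    rw [this, ← adjoint_inner_right, inner_self_eq_norm_sq_to_K]
    have hx : ‖x‖ ^ 2 * A ≤ ‖adjoint T (x : H)‖ ^ 2 := (mul_comm _ _).trans_le (h x x.2)
    simpa using! hx
  obtain ⟨x, hx⟩ := (isUnit_iff_bijective.1 hR).2 ⟨y, hy⟩
  exact ⟨adjoint T (x : H), congrArg Subtype.val hx⟩

end IsSynthesis

variable [∀ j, CompleteSpace (G j)]

theorem adjoint_starProjection_closedSpan (V : ∀ j, G j →L[ℂ] H)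
    [CompleteSpace (closedSpan V)] (j : ι) (f : H) :
    adjoint (V j) ((closedSpan V).starProjection f) = adjoint (V j) f := by
  refine ext_inner_right ℂ fun x => ?_
  rw [adjoint_inner_left, adjoint_inner_left, eq_comm, ← sub_eq_zero, ← inner_sub_left]
  exact starProjection_inner_eq_zero _ _ (apply_mem_closedSpan V j x)

/-- A Bessel bound on the closed span yields the synthesis operator. -/
theorem exists_isSynthesis (V : ∀ j, G j →L[ℂ] H) {B : ℝ}
    (hs : ∀ f ∈ closedSpan V, Summable fun j => ‖adjoint (V j) f‖ ^ 2)
    (hB : ∀ f ∈ closedSpan V, ∑' j, ‖adjoint (V j) f‖ ^ 2 ≤ B * ‖f‖ ^ 2) :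
    ∃ T : lp G 2 →L[ℂ] H, IsSynthesis V T := by
  classical
  have : CompleteSpace (closedSpan V) := (isClosed_closedSpan V).completeSpace_coe
  have hs' (f : H) : Summable fun j => ‖adjoint (V j) f‖ ^ 2 := by
    simpa only [adjoint_starProjection_closedSpan] using
      hs _ (starProjection_apply_mem (closedSpan V) f)
  let S₀ : H →ₗ[ℂ] lp G 2 :=
    { toFun f := ⟨fun j => adjoint (V j) f, memℓp_gen (by simpa using hs' f)⟩
      map_add' f g := lp.ext (funext fun j => map_add (adjoint (V j)) f g)
      map_smul' c f := lp.ext (funext fun j => map_smul (adjoint (V j)) c f) }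
  have hS₀ (f : H) : ‖S₀ f‖ ≤ √|B| * ‖f‖ := by
    refine le_of_sq_le_sq ?_ (by positivity)
    set p := (closedSpan V).starProjection f with hp
    calc ‖S₀ f‖ ^ 2 = ∑' j, ‖adjoint (V j) f‖ ^ 2 := (hasSum_norm_sq (S₀ f)).tsum_eq.symm
      _ = ∑' j, ‖adjoint (V j) p‖ ^ 2 := by
        simp only [hp, adjoint_starProjection_closedSpan]
      _ ≤ B * ‖p‖ ^ 2 := hB p (starProjection_apply_mem _ f)
      _ ≤ |B| * ‖f‖ ^ 2 := by
        gcongr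
        · exact le_abs_self B
        · exact norm_starProjection_apply_le _ f
      _ = (√|B| * ‖f‖) ^ 2 := by rw [mul_pow, Real.sq_sqrt (abs_nonneg B)]
  let S : H →L[ℂ] lp G 2 := S₀.mkContinuous _ hS₀
  refine ⟨adjoint S, fun f => ?_⟩
  have h := (lp.hasSum_single (by norm_num) f).mapL (adjoint S)
  convert h using 2 with j
  refine ext_inner_right ℂ fun y => ?_
  rw [adjoint_inner_left, lp.inner_single_left, ← adjoint_inner_right]
  rfl

end Synthesis

/-- `(W j, Λ j, v j)` is a g-fusion frame sequence (a g-fusion frame for the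
closed span `K` of `⋃ j, π_{W j} (Λ j)* (H_j)`) iff the synthesis operator
`T : ℋ₂ → H`, `T {f j} = ∑ j, v j • π_{W j} (Λ j)* (f j)`, is well-defined (and bounded) with
closed range; moreover, in that case the range of `T` equals `K`. -/
theorem stmt18 {ι : Type*} [Countable ι] {G : ι → Type*}
    [∀ j, NormedAddCommGroup (G j)] [∀ j, InnerProductSpace ℂ (G j)] [∀ j, CompleteSpace (G j)]
    (W : ι → Submodule ℂ H) [∀ j, CompleteSpace (W j)]
    (Λ : ∀ j, H →L[ℂ] G j) (v : ι → ℝ) (hv : ∀ j, 0 < v j) :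
    ((∃ A B : ℝ, 0 < A ∧ A ≤ B ∧
      ∀ f ∈ (Submodule.span ℂ
          (⋃ j, Set.range fun x : G j =>
            gfP (W j) (ContinuousLinearMap.adjoint (Λ j) x))).topologicalClosure,
        Summable (fun j => (v j) ^ 2 * ‖Λ j (gfP (W j) f)‖ ^ 2) ∧
        A * ‖f‖ ^ 2 ≤ ∑' j, (v j) ^ 2 * ‖Λ j (gfP (W j) f)‖ ^ 2 ∧
        ∑' j, (v j) ^ 2 * ‖Λ j (gfP (W j) f)‖ ^ 2 ≤ B * ‖f‖ ^ 2) ↔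
    (∃ T : lp G 2 →L[ℂ] H,
      (∀ f : lp G 2,
        HasSum (fun j => v j • gfP (W j) (ContinuousLinearMap.adjoint (Λ j) (f j))) (T f)) ∧
      IsClosed (Set.range T)))
    ∧
    (∀ T : lp G 2 →L[ℂ] H,
      (∀ f : lp G 2,
        HasSum (fun j => v j • gfP (W j) (ContinuousLinearMap.adjoint (Λ j) (f j))) (T f)) →
      IsClosed (Set.range T) →
      Set.range T = ((Submodule.span ℂ
        (⋃ j, Set.range fun x : G j =>
          gfP (W j) (ContinuousLinearMap.adjoint (Λ j) x))).topologicalClosure : Set H)) := by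
  let V : ∀ j, G j →L[ℂ] H := fun j => v j • (gfP (W j) ∘L adjoint (Λ j))
  have hadj (j : ι) (f : H) : ‖adjoint (V j) f‖ ^ 2 = v j ^ 2 * ‖Λ j (gfP (W j) f)‖ ^ 2 := by
    have h : adjoint (V j) f = (v j : ℂ) • Λ j (gfP (W j) f) := by
      refine ext_inner_right ℂ fun x => ?_
      have hV : V j x = (v j : ℂ) • gfP (W j) (adjoint (Λ j) x) := rfl
      rw [adjoint_inner_left, hV, inner_smul_right, inner_smul_left, Complex.conj_ofReal,
        ← adjoint_inner_left, adjoint_gfP, adjoint_inner_right]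
    rw [h, norm_smul, mul_pow]
    simp
  have hK : (Submodule.span ℂ (⋃ j, Set.range fun x : G j =>
      gfP (W j) (ContinuousLinearMap.adjoint (Λ j) x))).topologicalClosure = closedSpan V := by
    unfold closedSpan
    congr 3
    refine funext fun j => Subset.antisymm ?_ ?_
    · rintro _ ⟨x, rfl⟩
      refine ⟨(v j)⁻¹ • x, ?_⟩
      change v j • gfP (W j) (adjoint (Λ j) ((v j)⁻¹ • x)) = _
      rw [map_smul_of_tower, map_smul_of_tower, smul_inv_smul₀ (hv j).ne']
    · rintro _ ⟨x, rfl⟩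
      refine ⟨v j • x, ?_⟩
      change gfP (W j) (adjoint (Λ j) (v j • x)) = v j • gfP (W j) (adjoint (Λ j) x)
      rw [map_smul_of_tower, map_smul_of_tower]
  rw [hK]
  simp only [← hadj]
  refine ⟨⟨?_, ?_⟩, fun T hT hc => IsSynthesis.range_eq (V := V) hT hc⟩
  · rintro ⟨A, B, hA, -, h⟩
    obtain ⟨T, hT⟩ := exists_isSynthesis V (fun f hf => (h f hf).1) fun f hf => (h f hf).2.2
    refine ⟨T, hT, ?_⟩
    rw [hT.range_eq_of_lower_bound hA fun f hf =>
      (h f hf).2.1.trans_eq (hT.hasSum_norm_adjoint f).tsum_eq]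
    exact isClosed_closedSpan V
  · rintro ⟨T, hT : IsSynthesis V T, hc⟩
    obtain ⟨C, hC, h⟩ := hT.exists_lower_bound hc
    refine ⟨(C ^ 2)⁻¹, max (C ^ 2)⁻¹ (‖adjoint T‖ ^ 2), by positivity, le_max_left _ _,
      fun f hf => ⟨(hT.hasSum_norm_adjoint f).summable, ?_⟩⟩
    rw [(hT.hasSum_norm_adjoint f).tsum_eq]
    constructor
    · rw [inv_mul_le_iff₀ (by positivity), ← mul_pow]
      gcongr
      exact h f hf
    · calc ‖adjoint T f‖ ^ 2 ≤ (‖adjoint T‖ * ‖f‖) ^ 2 := by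
            gcongr
            exact le_opNorm _ f
        _ = ‖adjoint T‖ ^ 2 * ‖f‖ ^ 2 := mul_pow _ _ _
        _ ≤ _ := by
            gcongr
            exact le_max_right _ _
end
end
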